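/- arXiv:2501.17197 — 5 statements merged into one kernel-verified Lean document; each statement's English description precedes it below -/
import Mathlib

section
/- Let K ⊆ L be finite fields of characteristic p and G a finite group. Let V be an indecomposable KG-module and U an indecomposable LG-module. Then U | V ⊗_K L (i.e., U is isomorphic to a direct summand of the base change of V to L) if and only if V | Res_K(U) (i.e., V is isomorphic to a direct summand of U regarded as a KG-module by restriction of scalars). -/
open TensorProduct

/-- Base change of a representation along a (commutative) algebra `k → L`:
the `L`-linear representation of `G` on `V ⊗_k L = L ⊗[k] V`. -/
noncomputable def repBaseChange {k : Type*} [CommRing k] (L : Type*) [CommRing L] [Algebra k L]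
    {G : Type*} [Monoid G] {V : Type*} [AddCommGroup V] [Module k V]
    (ρ : Representation k G V) : Representation L G (L ⊗[k] V) :=
  (Module.End.baseChangeHom k L V).toRingHom.toMonoidHom.comp ρ

/-- Restriction of scalars `Res_K` of a representation along `K ⊆ L`. -/
def repRes (K : Type*) {L : Type*} [CommRing K] [CommRing L] [Algebra K L]
    {G : Type*} [Monoid G] {U : Type*} [AddCommGroup U] [Module K U] [Module L U]
    [IsScalarTower K L U] (ρ : Representation L G U) : Representation K G U where
  toFun g := (ρ g).restrictScalars K
  map_one' := by ext u; simp
  map_mul' g h := by ext u; simp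

/-- Two representations of `G` over `k` are isomorphic iff the corresponding modules over the
group algebra `MonoidAlgebra k G` are linearly equivalent. -/
def RepIso {k : Type*} [CommSemiring k] {G : Type*} [Monoid G]
    {V W : Type*} [AddCommMonoid V] [Module k V] [AddCommMonoid W] [Module k W]
    (ρ : Representation k G V) (τ : Representation k G W) : Prop :=
  Nonempty (ρ.asModule ≃ₗ[MonoidAlgebra k G] τ.asModule)

/-- `ρ | τ` : `ρ` is (isomorphic to) a direct summand of `τ`, i.e. `τ` is the internal direct
sum of two submodules (over the group algebra `MonoidAlgebra k G`), the first of which is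
isomorphic to `ρ`. -/
def RepSummand {k : Type*} [CommSemiring k] {G : Type*} [Monoid G]
    {V W : Type*} [AddCommMonoid V] [Module k V] [AddCommMonoid W] [Module k W]
    (ρ : Representation k G V) (τ : Representation k G W) : Prop :=
  ∃ A B : Submodule (MonoidAlgebra k G) τ.asModule,
    IsCompl A B ∧ Nonempty (ρ.asModule ≃ₗ[MonoidAlgebra k G] A)

/-- A representation is indecomposable if it is nonzero and the corresponding module over the
group algebra is not the internal direct sum of two nonzero submodules. -/
def RepIndecomposable {k : Type*} [CommSemiring k] {G : Type*} [Monoid G]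
    {V : Type*} [AddCommMonoid V] [Module k V] (ρ : Representation k G V) : Prop :=
  Nontrivial V ∧
    ∀ A B : Submodule (MonoidAlgebra k G) ρ.asModule, IsCompl A B → A = ⊥ ∨ B = ⊥

/-- A representation is simple if the corresponding module over the group algebra is simple. -/
def RepSimple {k : Type*} [CommRing k] {G : Type*} [Monoid G]
    {V : Type*} [AddCommGroup V] [Module k V] (ρ : Representation k G V) : Prop :=
  IsSimpleModule (MonoidAlgebra k G) ρ.asModule

section Intertwining

variable {k G V W : Type*} [Field k] [Group G] [AddCommGroup V] [Module k V]
  [AddCommGroup W] [Module k W]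

theorem repSummand_iff_exists_comp_eq_id {ρ : Representation k G V} {τ : Representation k G W} :
    RepSummand ρ τ ↔ ∃ (i : ρ.IntertwiningMap τ) (r : τ.IntertwiningMap ρ),
      ∀ v, r (i v) = v := by
  constructor
  · rintro ⟨A, B, hAB, ⟨e⟩⟩
    refine ⟨(Representation.IntertwiningMap.equivLinearMapAsModule ρ τ).symm
        (A.subtype ∘ₗ e.toLinearMap),
      (Representation.IntertwiningMap.equivLinearMapAsModule τ ρ).symm
        (e.symm.toLinearMap ∘ₗ A.projectionOnto B hAB), fun v => ?_⟩
    change e.symm (A.projectionOnto B hAB (e v)) = v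
    rw [Submodule.projectionOnto_apply_left]
    exact e.symm_apply_apply v
  · rintro ⟨i, r, h⟩
    let i' := Representation.IntertwiningMap.equivLinearMapAsModule ρ τ i
    let r' := Representation.IntertwiningMap.equivLinearMapAsModule τ ρ r
    have h' : ∀ v, r' (i' v) = v := h
    refine ⟨LinearMap.range i', LinearMap.ker r', ?_,
      ⟨LinearEquiv.ofInjective i' (Function.LeftInverse.injective h')⟩⟩
    constructor
    · rw [Submodule.disjoint_def]
      rintro _ ⟨v, rfl⟩ hv
      rw [LinearMap.mem_ker, h'] at hv
      rw [hv, map_zero]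
    · rw [codisjoint_iff, eq_top_iff]
      intro w _
      refine Submodule.mem_sup.2 ⟨i' (r' w), ⟨_, rfl⟩, w - i' (r' w), ?_, by abel⟩
      rw [LinearMap.mem_ker, map_sub, h', sub_self]

/-- Fitting's lemma for endomorphisms of an indecomposable representation. -/
theorem RepIndecomposable.isNilpotent_or_bijective [FiniteDimensional k V]
    {ρ : Representation k G V} (hρ : RepIndecomposable ρ) (f : ρ.IntertwiningMap ρ) :
    IsNilpotent f.toLinearMap ∨ Function.Bijective f := by
  let f' : Module.End (MonoidAlgebra k G) ρ.asModule :=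
    Representation.IntertwiningMap.equivLinearMapAsModule ρ ρ f
  have : Module.Finite k ρ.asModule := inferInstance
  have : IsNoetherian (MonoidAlgebra k G) ρ.asModule := isNoetherian_of_tower k inferInstance
  have : IsArtinian (MonoidAlgebra k G) ρ.asModule := isArtinian_of_tower k inferInstance
  obtain ⟨n, hn, hn1⟩ :=
    (f'.eventually_isCompl_ker_pow_range_pow.and (Filter.eventually_ge_atTop 1)).exists
  have hpow : ∀ m v, (f' ^ m) v = (f.toLinearMap ^ m) v := by
    intro m
    induction m with
    | zero => intro v; rfl
    | succ m ih =>
      intro v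
      rw [pow_succ, pow_succ]
      exact ih (f' v)
  rcases hρ.2 _ _ hn with h | h
  · right
    have hinj : Function.Injective (f' ^ n) := LinearMap.ker_eq_bot.1 h
    have hinj' : Function.Injective f.toLinearMap := by
      rw [← LinearMap.ker_eq_bot, LinearMap.ker_eq_bot']
      intro v hv
      refine hinj (a₂ := 0) ?_
      obtain ⟨m, rfl⟩ : ∃ m, n = m + 1 := ⟨n - 1, by omega⟩
      refine (hpow (m + 1) v).trans (Eq.trans ?_ (map_zero (f' ^ (m + 1))).symm)
      rw [pow_succ]
      exact (congrArg (f.toLinearMap ^ m) hv).trans (map_zero _)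
    exact ⟨hinj', LinearMap.injective_iff_surjective.1 hinj'⟩
  · left
    refine ⟨n, LinearMap.ext fun v => ?_⟩
    exact (hpow n v).symm.trans (LinearMap.congr_fun (LinearMap.range_eq_bot.1 h) v)

theorem RepIndecomposable.isNilpotent_comp_of_not_repSummand [FiniteDimensional k V]
    {ρ : Representation k G V} {τ : Representation k G W} (hρ : RepIndecomposable ρ)
    (h : ¬ RepSummand ρ τ) (i : ρ.IntertwiningMap τ) (r : τ.IntertwiningMap ρ) :
    IsNilpotent (r.toLinearMap ∘ₗ i.toLinearMap) := by
  refine (hρ.isNilpotent_or_bijective (r.comp i)).resolve_right fun hb => h ?_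
  let e := (r.comp i).ofBijective hb
  exact repSummand_iff_exists_comp_eq_id.2
    ⟨i, e.symm.toIntertwiningMap.comp r, fun v => e.symm_apply_apply v⟩

theorem isNilpotent_comp_swap {f : V →ₗ[k] W} {g : W →ₗ[k] V} (h : IsNilpotent (g ∘ₗ f)) :
    IsNilpotent (f ∘ₗ g) := by
  obtain ⟨n, hn⟩ := h
  have key : ∀ m v, ((f ∘ₗ g) ^ (m + 1)) v = f (((g ∘ₗ f) ^ m) (g v)) := by
    intro m
    induction m with
    | zero => intro v; simp
    | succ m ih => intro v; rw [pow_succ, Module.End.mul_apply, ih]; rw [pow_succ]; rfl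
  exact ⟨n + 1, LinearMap.ext fun v => by rw [key, hn]; simp⟩

/-- If every `x j` lies in the Jacobson radical of the ring of intertwining endomorphisms of a
nonzero representation, then the `x j` cannot add up to the identity. -/
theorem sum_ne_one_of_isNilpotent_mul [Nontrivial V] {ρ : Representation k G V}
    {ι : Type*} [Fintype ι] (x : ι → Module.End k V)
    (hx : ∀ j g v, x j (ρ g v) = ρ g (x j v))
    (hnil : ∀ j (y : ρ.IntertwiningMap ρ), IsNilpotent (y.toLinearMap * x j)) :
    ∑ j, x j ≠ 1 := by
  intro hsum
  let B := Subalgebra.centralizer k (Set.range ρ)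
  have hmem : ∀ y : Module.End k V, y ∈ B ↔ ∀ g v, y (ρ g v) = ρ g (y v) := by
    intro y
    rw [Subalgebra.mem_centralizer_iff]
    constructor
    · intro h g v
      exact (LinearMap.congr_fun (h _ ⟨g, rfl⟩) v).symm
    · rintro h _ ⟨g, rfl⟩
      exact LinearMap.ext fun v => (h g v).symm
  let X : ι → B := fun j => ⟨x j, (hmem _).2 (hx j)⟩
  have hX : ∀ j, X j ∈ Ideal.jacobson (⊥ : Ideal B) := by
    intro j
    rw [Ideal.mem_jacobson_iff]
    intro y
    have hn : IsNilpotent (y * X j) := by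
      obtain ⟨n, hn⟩ := hnil j
        (LinearMap.intertwiningMap_of_isIntertwiningMap ρ ρ y.1 ((hmem _).1 y.2))
      exact ⟨n, Subtype.ext hn⟩
    obtain ⟨u, hu⟩ := hn.isUnit_add_one
    refine ⟨↑u⁻¹, ?_⟩
    have : (↑u⁻¹ : B) * (y * X j + 1) = 1 := by rw [← hu, Units.inv_mul]
    rw [mul_add, mul_one, ← mul_assoc] at this
    rw [this, sub_self]
    exact zero_mem _
  have h1 : (1 : B) ∈ Ideal.jacobson (⊥ : Ideal B) := by
    have : ∑ j, X j = 1 := Subtype.ext (by simpa [X] using hsum)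
    rw [← this]
    exact sum_mem fun j _ => hX j
  rw [← Ideal.eq_top_iff_one, Ideal.jacobson_eq_top_iff] at h1
  exact bot_ne_top h1

end Intertwining

theorem repBaseChange_apply_tmul {k L G V : Type*} [CommRing k] [CommRing L] [Algebra k L]
    [Group G] [AddCommGroup V] [Module k V] (ρ : Representation k G V) (g : G) (l : L) (v : V) :
    repBaseChange L ρ g (l ⊗ₜ v) = l ⊗ₜ ρ g v := rfl

section Field

variable {K L G V U : Type*} [Field K] [Field L] [Algebra K L] [Group G]
  [AddCommGroup V] [Module K V] [AddCommGroup U] [Module K U] [Module L U] [IsScalarTower K L U]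

theorem repSummand_repRes_of_repSummand_repBaseChange [FiniteDimensional K L]
    [FiniteDimensional K V] {ρV : Representation K G V} (hV : RepIndecomposable ρV)
    [Nontrivial U] {ρU : Representation L G U} (h : RepSummand ρU (repBaseChange L ρV)) :
    RepSummand ρV (repRes K ρU) := by
  obtain ⟨i, r, hir⟩ := repSummand_iff_exists_comp_eq_id.1 h
  by_contra hs
  let e := Module.finBasis K L
  let inc : ∀ j, ρV.IntertwiningMap (repRes K ρU) := fun j =>
    LinearMap.intertwiningMap_of_isIntertwiningMap _ _
      (r.toLinearMap.restrictScalars K ∘ₗ TensorProduct.mk K L V (e j))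
      (fun g v => r.isIntertwining _ _ g (e j ⊗ₜ v))
  let coord : ∀ j, L ⊗[K] V →ₗ[K] V := fun j =>
    (TensorProduct.lid K V).toLinearMap ∘ₗ (e.coord j).rTensor V
  have coord_comm : ∀ j g x, coord j (repBaseChange L ρV g x) = ρV g (coord j x) := by
    intro j g x
    induction x with
    | zero => simp
    | tmul l v => simp [coord, repBaseChange_apply_tmul]
    | add x y hx hy => simp only [map_add, hx, hy]
  let pr : ∀ j, (repRes K ρU).IntertwiningMap ρV := fun j =>
    LinearMap.intertwiningMap_of_isIntertwiningMap _ _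
      (coord j ∘ₗ i.toLinearMap.restrictScalars K)
      (fun g u => by
        change coord j (i (ρU g u)) = ρV g (coord j (i u))
        rw [i.isIntertwining, coord_comm])
  have coord_sum : ∀ x, ∑ j, e j ⊗ₜ[K] coord j x = x := by
    intro x
    induction x with
    | zero => simp
    | tmul l v =>
      simp only [coord, LinearMap.comp_apply, LinearMap.rTensor_tmul, LinearEquiv.coe_coe,
        TensorProduct.lid_tmul, Module.Basis.coord_apply, ← TensorProduct.smul_tmul,
        ← TensorProduct.sum_tmul, e.sum_repr]
    | add x y hx hy => simp only [map_add, TensorProduct.tmul_add, Finset.sum_add_distrib, hx, hy]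
  refine sum_ne_one_of_isNilpotent_mul (ρ := repRes K ρU)
    (fun j => (inc j).toLinearMap ∘ₗ (pr j).toLinearMap)
    (fun j => ((inc j).comp (pr j)).isIntertwining _ _)
    (fun j y => isNilpotent_comp_swap (f := y.toLinearMap ∘ₗ (inc j).toLinearMap)
      (hV.isNilpotent_comp_of_not_repSummand hs (y.comp (inc j)) (pr j))) ?_
  ext u
  rw [LinearMap.sum_apply]
  change ∑ j, r (e j ⊗ₜ coord j (i u)) = u
  rw [← map_sum, coord_sum, hir]

theorem sum_basis_tmul_traceDual_mul [FiniteDimensional K L] [Algebra.IsSeparable K L]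
    {ι : Type*} [Fintype ι] [DecidableEq ι] (e : Module.Basis ι K L) (c : L) :
    ∑ j, e j ⊗ₜ[K] (e.traceDual j * c) = ∑ j, (c * e j) ⊗ₜ[K] e.traceDual j := by
  have h1 : ∀ x, ∑ k, Algebra.trace K L (x * e k) • e.traceDual k = x := fun x => by
    simpa using e.traceDual.sum_repr x
  have h2 : ∀ x, ∑ k, Algebra.trace K L (e.traceDual k * x) • e k = x := fun x => by
    have hrepr : ∀ k, Algebra.trace K L (e.traceDual k * x) = e.repr x k := fun k => by
      have := e.traceDual.traceDual_repr_apply x k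
      rw [Module.Basis.traceDual_traceDual, Algebra.traceForm_apply] at this
      rw [this, mul_comm]
    simp only [hrepr, e.sum_repr]
  calc ∑ j, e j ⊗ₜ[K] (e.traceDual j * c)
      = ∑ j, ∑ k, (Algebra.trace K L (e.traceDual j * (c * e k)) • e j) ⊗ₜ[K] e.traceDual k := by
        refine Finset.sum_congr rfl fun j _ => ?_
        conv_lhs => rw [← h1 (e.traceDual j * c), TensorProduct.tmul_sum]
        simp only [TensorProduct.smul_tmul, mul_assoc]
    _ = _ := by
        rw [Finset.sum_comm]
        simp only [← TensorProduct.sum_tmul, h2]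

theorem rTensor_algEquiv_smul (σ : L ≃ₐ[K] L) (c : L) (x : L ⊗[K] V) :
    σ.toLinearMap.rTensor V (c • x) = σ c • σ.toLinearMap.rTensor V x := by
  induction x with
  | zero => simp
  | tmul l v => simp [TensorProduct.smul_tmul']
  | add x y hx hy => simp only [smul_add, map_add, hx, hy]

theorem rTensor_algEquiv_inv_apply (σ : L ≃ₐ[K] L) (x : L ⊗[K] V) :
    σ⁻¹.toLinearMap.rTensor V (σ.toLinearMap.rTensor V x) = x := by
  induction x with
  | zero => simp
  | tmul l v => simp
  | add x y hx hy => simp only [map_add, hx, hy]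

theorem rTensor_algEquiv_apply_inv (σ : L ≃ₐ[K] L) (x : L ⊗[K] V) :
    σ.toLinearMap.rTensor V (σ⁻¹.toLinearMap.rTensor V x) = x := by
  simpa using rTensor_algEquiv_inv_apply σ⁻¹ x

theorem rTensor_algEquiv_repBaseChange (ρ : Representation K G V) (σ : L ≃ₐ[K] L) (g : G)
    (x : L ⊗[K] V) :
    σ.toLinearMap.rTensor V (repBaseChange L ρ g x) =
      repBaseChange L ρ g (σ.toLinearMap.rTensor V x) := by
  induction x with
  | zero => simp
  | tmul l v => simp [repBaseChange_apply_tmul]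
  | add x y hx hy => simp only [map_add, hx, hy]

/-- Conjugation of the endomorphisms of `L ⊗[K] V` by a field automorphism of `L` over `K`. -/
noncomputable def baseChangeGalConj (V : Type*) [AddCommGroup V] [Module K V] (σ : L ≃ₐ[K] L) :
    Module.End L (L ⊗[K] V) →+* Module.End L (L ⊗[K] V) where
  toFun f :=
    { toFun := fun x => σ.toLinearMap.rTensor V (f (σ⁻¹.toLinearMap.rTensor V x))
      map_add' := fun x y => by simp only [map_add]
      map_smul' := fun c x => by
        rw [rTensor_algEquiv_smul, map_smul, rTensor_algEquiv_smul, RingHom.id_apply]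
        congr 1
        exact σ.apply_symm_apply c }
  map_one' := LinearMap.ext (rTensor_algEquiv_apply_inv σ)
  map_mul' f g := LinearMap.ext fun x => by
    change σ.toLinearMap.rTensor V (f (g _)) = σ.toLinearMap.rTensor V (f
      (σ⁻¹.toLinearMap.rTensor V (σ.toLinearMap.rTensor V (g _))))
    rw [rTensor_algEquiv_inv_apply]
  map_zero' := LinearMap.ext fun x => map_zero (σ.toLinearMap.rTensor V)
  map_add' f g := LinearMap.ext fun x => map_add (σ.toLinearMap.rTensor V) _ _

theorem baseChangeGalConj_apply (σ : L ≃ₐ[K] L) (f : Module.End L (L ⊗[K] V)) (x : L ⊗[K] V) :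
    baseChangeGalConj V σ f x = σ.toLinearMap.rTensor V (f (σ⁻¹.toLinearMap.rTensor V x)) := rfl

theorem baseChangeGalConj_inv_apply (σ : L ≃ₐ[K] L) (f : Module.End L (L ⊗[K] V)) :
    baseChangeGalConj V σ (baseChangeGalConj V σ⁻¹ f) = f := by
  refine LinearMap.ext fun x => ?_
  simp only [baseChangeGalConj_apply, inv_inv, rTensor_algEquiv_apply_inv]

theorem baseChangeGalConj_isIntertwining (ρ : Representation K G V) (σ : L ≃ₐ[K] L)
    (f : (repBaseChange L ρ).IntertwiningMap (repBaseChange L ρ)) (g : G) (x : L ⊗[K] V) :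
    baseChangeGalConj V σ f.toLinearMap (repBaseChange L ρ g x) =
      repBaseChange L ρ g (baseChangeGalConj V σ f.toLinearMap x) := by
  simp only [baseChangeGalConj_apply, rTensor_algEquiv_repBaseChange,
    Representation.IntertwiningMap.toLinearMap_apply,
    Representation.IntertwiningMap.isIntertwining]

theorem repSummand_repBaseChange_of_repSummand_repRes [FiniteDimensional K L] [IsGalois K L]
    [FiniteDimensional L U] {ρV : Representation K G V} [Nontrivial V]
    {ρU : Representation L G U} (hU : RepIndecomposable ρU)
    (h : RepSummand ρV (repRes K ρU)) : RepSummand ρU (repBaseChange L ρV) := by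
  obtain ⟨i, r, hir⟩ := repSummand_iff_exists_comp_eq_id.1 h
  by_contra hs
  classical
  let e := Module.finBasis K L
  let a : (repBaseChange L ρV).IntertwiningMap ρU :=
    LinearMap.intertwiningMap_of_isIntertwiningMap _ _ (i.toLinearMap.liftBaseChange L)
      (fun g x => by
        induction x with
        | zero => simp
        | tmul l v =>
          simp only [repBaseChange_apply_tmul, LinearMap.liftBaseChange_tmul, map_smul]
          exact congrArg (l • ·) (i.isIntertwining _ _ g v)
        | add x y hx hy => simp only [map_add, hx, hy])
  let b : ρU.IntertwiningMap (repBaseChange L ρV) :=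
    LinearMap.intertwiningMap_of_isIntertwiningMap _ _
      { toFun := fun u => ∑ j, e j ⊗ₜ r (e.traceDual j • u)
        map_add' := fun u u' => by
          simp only [smul_add, map_add, TensorProduct.tmul_add, Finset.sum_add_distrib]
        map_smul' := fun c u => by
          have := congrArg (LinearMap.lTensor L
            (r.toLinearMap ∘ₗ (LinearMap.toSpanSingleton L U u).restrictScalars K))
            (sum_basis_tmul_traceDual_mul e c)
          simpa [Finset.smul_sum, TensorProduct.smul_tmul', mul_smul] using this }
      (fun g u => by
        change ∑ j, e j ⊗ₜ r (e.traceDual j • ρU g u) =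
          repBaseChange L ρV g (∑ j, e j ⊗ₜ r (e.traceDual j • u))
        rw [map_sum]
        refine Finset.sum_congr rfl fun j _ => ?_
        rw [repBaseChange_apply_tmul, ← map_smul]
        exact congrArg (e j ⊗ₜ[K] ·) (r.isIntertwining _ _ g _))
  refine sum_ne_one_of_isNilpotent_mul (ρ := repBaseChange L ρV)
    (fun σ : L ≃ₐ[K] L => baseChangeGalConj V σ (b.comp a).toLinearMap)
    (fun σ => baseChangeGalConj_isIntertwining ρV σ (b.comp a)) (fun σ y => ?_) ?_
  · let y' : (repBaseChange L ρV).IntertwiningMap (repBaseChange L ρV) :=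
      LinearMap.intertwiningMap_of_isIntertwiningMap _ _ (baseChangeGalConj V σ⁻¹ y.toLinearMap)
        (baseChangeGalConj_isIntertwining ρV σ⁻¹ y)
    rw [← baseChangeGalConj_inv_apply σ y.toLinearMap, ← map_mul]
    exact (isNilpotent_comp_swap (hU.isNilpotent_comp_of_not_repSummand hs (y'.comp b) a)).map
      (baseChangeGalConj V σ)
  · have htrace : ∑ j, Algebra.trace K L (e j) • e.traceDual j = 1 := by
      simpa using e.traceDual.sum_repr 1
    have hconj : ∀ σ : L ≃ₐ[K] L, ∀ v, baseChangeGalConj V σ (b.comp a).toLinearMap (1 ⊗ₜ v) =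
        ∑ j, σ (e j) ⊗ₜ r (e.traceDual j • i v) := by
      intro σ v
      rw [baseChangeGalConj_apply, LinearMap.rTensor_tmul, AlgEquiv.toLinearMap_apply, map_one]
      change σ.toLinearMap.rTensor V (∑ j, e j ⊗ₜ r (e.traceDual j • (1 : L) • i v)) = _
      simp
    ext v
    simp only [TensorProduct.AlgebraTensorModule.curry_apply,
      TensorProduct.curry_apply, LinearMap.coe_restrictScalars, LinearMap.sum_apply, hconj,
      Module.End.one_apply]
    rw [Finset.sum_comm]
    simp only [← TensorProduct.sum_tmul, ← trace_eq_sum_automorphisms,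
      Algebra.algebraMap_eq_smul_one, TensorProduct.smul_tmul]
    rw [← TensorProduct.tmul_sum]
    simp only [← map_smul, ← smul_assoc]
    rw [← map_sum, ← Finset.sum_smul, htrace, one_smul, hir]

end Field

/-- Let `K ⊆ L` be finite fields of characteristic `p` and `G` a finite group, `V` an
indecomposable `KG`-module and `U` an indecomposable `LG`-module.  Then `U | V ⊗_K L` iff
`V | Res_K U`. -/
theorem summand_baseChange_iff_summand_res (p : ℕ) [Fact p.Prime]
    (K L : Type) [Field K] [Field L] [Finite K] [Finite L] [CharP K p] [CharP L p]
    [Algebra K L]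
    (G : Type) [Group G] [Finite G]
    (V : Type) [AddCommGroup V] [Module K V] [FiniteDimensional K V]
    (ρV : Representation K G V) (hV : RepIndecomposable ρV)
    (U : Type) [AddCommGroup U] [Module K U] [Module L U] [IsScalarTower K L U]
    [FiniteDimensional L U]
    (ρU : Representation L G U) (hU : RepIndecomposable ρU) :
    RepSummand ρU (repBaseChange L ρV) ↔ RepSummand ρV (repRes K ρU) := by
  have := hV.1
  have := hU.1
  exact ⟨repSummand_repRes_of_repSummand_repBaseChange hV,
    repSummand_repBaseChange_of_repSummand_repRes hU⟩
end

section
/- Let p be a prime, F = 𝔽_p, G a finite group, K a finite field extension of F, W an indecomposable FG-module, and V an indecomposable KG-module with V | W ⊗_F K. Then there exists a positive integer s such that Res_F(V), the FG-module obtained from V by restriction of scalars, is isomorphic to the direct sum of s copies of W. -/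
open TensorProduct

section KrullSchmidt

variable {R : Type*} [Ring R]

/-- Fitting's lemma: an indecomposable module of finite length has a local endomorphism ring. -/
theorem isLocalRing_end_of_indecomposable {M : Type*} [AddCommGroup M] [Module R M]
    [IsNoetherian R M] [IsArtinian R M] [Nontrivial M]
    (hM : ∀ A B : Submodule R M, IsCompl A B → A = ⊥ ∨ B = ⊥) :
    IsLocalRing (Module.End R M) := by
  refine IsLocalRing.of_isUnit_or_isUnit_one_sub_self fun f ↦ ?_
  obtain ⟨n, hn, hn1⟩ :=
    (f.eventually_isCompl_ker_pow_range_pow.and (Filter.eventually_ge_atTop 1)).exists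
  rcases hM _ _ hn with h | h
  · left
    have hf : IsUnit (f ^ n) := (Module.End.isUnit_iff _).2 <|
      IsArtinian.bijective_of_injective_endomorphism _ (LinearMap.ker_eq_bot.1 h)
    exact (isUnit_pow_iff (by omega)).1 hf
  · exact Or.inr (IsNilpotent.isUnit_one_sub ⟨n, LinearMap.range_eq_bot.1 h⟩)

/-- If `r ∘ i` is an automorphism of a nonzero module `M` and the codomain `W` of `i` is
indecomposable, then `M` is isomorphic to `W`. -/
theorem nonempty_linearEquiv_of_isUnit_comp {M W : Type*} [AddCommGroup M] [Module R M]
    [AddCommGroup W] [Module R W] [Nontrivial M]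
    (hW : ∀ A B : Submodule R W, IsCompl A B → A = ⊥ ∨ B = ⊥)
    (i : M →ₗ[R] W) (r : W →ₗ[R] M) (h : IsUnit (r ∘ₗ i : Module.End R M)) :
    Nonempty (M ≃ₗ[R] W) := by
  have hb : Function.Bijective (r ∘ₗ i) := (Module.End.isUnit_iff _).1 h
  have hc : IsCompl (LinearMap.range i) (LinearMap.ker r) := by
    constructor
    · rw [Submodule.disjoint_def]
      rintro _ ⟨m, rfl⟩ hm
      rw [show m = 0 from hb.1 (by simpa using hm), map_zero]
    · rw [codisjoint_iff, Submodule.eq_top_iff']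
      intro w
      obtain ⟨m, hm⟩ := hb.2 (r w)
      refine Submodule.mem_sup.2 ⟨i m, ⟨m, rfl⟩, w - i m, ?_, by abel⟩
      rw [LinearMap.mem_ker, map_sub, ← hm, LinearMap.comp_apply, sub_self]
  rcases hW _ _ hc with h0 | h0
  · obtain ⟨m, hm⟩ := exists_ne (0 : M)
    have hi : i = 0 := LinearMap.range_eq_bot.1 h0
    exact absurd (hb.1 (by simp [hi])) hm
  · exact ⟨(LinearEquiv.ofBijective r
      ⟨LinearMap.ker_eq_bot.1 h0, Function.Surjective.of_comp hb.2⟩).symm⟩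

/-- A direct summand of a finite power of an indecomposable module `W` is isomorphic to a finite
power of `W`. The summand `M` has finite length, and is presented by components of
the inclusion into and the retraction from the power. -/
theorem exists_linearEquiv_fin_fun_of_retract {W : Type*} [AddCommGroup W] [Module R W]
    (hW : ∀ A B : Submodule R W, IsCompl A B → A = ⊥ ∨ B = ⊥) {ι : Type*} [Fintype ι]
    {M : Type*} [AddCommGroup M] [Module R M] [IsNoetherian R M] [IsArtinian R M]
    (i : ι → M →ₗ[R] W) (r : ι → W →ₗ[R] M) (hri : ∑ k, r k ∘ₗ i k = LinearMap.id) :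
    ∃ s : ℕ, Nonempty (M ≃ₗ[R] (Fin s → W)) := by
  obtain ⟨l, hl⟩ : ∃ l, Module.length R M = l := ⟨_, rfl⟩
  induction l using WellFoundedLT.induction generalizing M with
  | ind l ih =>
  rcases subsingleton_or_nontrivial M with hM | hM
  · exact ⟨0, ⟨LinearEquiv.ofSubsingleton _ _⟩⟩
  by_cases hind : ∀ A B : Submodule R M, IsCompl A B → A = ⊥ ∨ B = ⊥
  · have := isLocalRing_end_of_indecomposable hind
    have h1 : IsUnit (∑ k, (r k ∘ₗ i k : Module.End R M)) := by
      rw [hri]; exact isUnit_one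
    obtain ⟨k, -, hk⟩ := IsLocalRing.exists_of_isUnit_sum h1
    obtain ⟨e⟩ := nonempty_linearEquiv_of_isUnit_comp hW (i k) (r k) hk
    exact ⟨1, ⟨e ≪≫ₗ (LinearEquiv.funUnique (Fin 1) R W).symm⟩⟩
  · push Not at hind
    obtain ⟨A, B, hAB, hA, hB⟩ := hind
    have key : ∀ A B : Submodule R M, IsCompl A B → B ≠ ⊥ →
        ∃ s : ℕ, Nonempty (A ≃ₗ[R] (Fin s → W)) := by
      intro A B hAB hB
      refine ih _ ?_ (fun k ↦ i k ∘ₗ A.subtype) (fun k ↦ A.projectionOnto B hAB ∘ₗ r k) ?_ rfl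
      · rw [← hl]
        refine Submodule.length_lt fun hA ↦ hB ?_
        simpa [hA] using hAB.disjoint
      · ext a
        have := congrArg (A.projectionOnto B hAB) (LinearMap.congr_fun hri (a : M))
        simp only [LinearMap.sum_apply, map_sum, LinearMap.comp_apply, LinearMap.id_apply,
          Submodule.projectionOnto_apply_left] at this
        simpa using congrArg Subtype.val this
    obtain ⟨s, ⟨e⟩⟩ := key A B hAB hB
    obtain ⟨t, ⟨f⟩⟩ := key B A hAB.symm hA
    exact ⟨s + t, ⟨(Submodule.prodEquivOfIsCompl A B hAB).symm ≪≫ₗ e.prodCongr f ≪≫ₗ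
      (LinearEquiv.sumArrowLequivProdArrow _ _ R W).symm ≪≫ₗ
      LinearEquiv.funCongrLeft R W finSumFinEquiv.symm⟩⟩

end KrullSchmidt

/-- The coordinates of `x : L ⊗[k] W` along a basis of `L` over `k` recover `x`. -/
theorem sum_basis_tmul_coord {k L W ι : Type*} [CommRing k] [CommRing L] [Algebra k L]
    [AddCommGroup W] [Module k W] [Fintype ι] (b : Module.Basis ι k L) (x : L ⊗[k] W) :
    ∑ j, b j ⊗ₜ[k] TensorProduct.lid k W ((b.coord j).rTensor W x) = x := by
  induction x with
  | zero => simp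
  | add x y hx hy => simp only [map_add, TensorProduct.tmul_add, Finset.sum_add_distrib, hx, hy]
  | tmul a w =>
    simp only [LinearMap.rTensor_tmul, TensorProduct.lid_tmul, ← TensorProduct.smul_tmul,
      ← TensorProduct.sum_tmul, Module.Basis.coord_apply, b.sum_repr]

/-- A direct summand comes with an inclusion and a retraction. -/
theorem RepSummand.exists_retraction {k : Type*} [CommRing k] {G : Type*} [Monoid G]
    {V W : Type*} [AddCommGroup V] [Module k V] [AddCommGroup W] [Module k W]
    {ρ : Representation k G V} {τ : Representation k G W} (h : RepSummand ρ τ) :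
    ∃ (i : Representation.IntertwiningMap ρ τ) (r : Representation.IntertwiningMap τ ρ),
      ∀ v, r (i v) = v := by
  obtain ⟨A, B, hAB, ⟨e⟩⟩ := h
  refine ⟨(Representation.IntertwiningMap.equivLinearMapAsModule ρ τ).symm
    (A.subtype ∘ₗ e.toLinearMap),
    (Representation.IntertwiningMap.equivLinearMapAsModule τ ρ).symm
    (e.symm.toLinearMap ∘ₗ A.projectionOnto B hAB), fun v ↦ ?_⟩
  change e.symm (A.projectionOnto B hAB (e (ρ.asModuleEquiv.symm v))) = ρ.asModuleEquiv.symm v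
  rw [Submodule.projectionOnto_apply_left, e.symm_apply_apply]

section Intertwining

variable {k : Type*} [CommRing k] {L : Type*} [CommRing L] [Algebra k L] {G : Type*} [Monoid G]
  {W : Type*} [AddCommGroup W] [Module k W] {V : Type*} [AddCommGroup V] [Module k V] [Module L V]
  [IsScalarTower k L V]

theorem repBaseChange_apply_tmul_s2 (ρ : Representation k G W) (g : G) (a : L) (w : W) :
    repBaseChange L ρ g (a ⊗ₜ[k] w) = a ⊗ₜ[k] ρ g w :=
  rfl

/-- A coordinate functional on `L` turns a morphism into the base change of `ρW` into a morphism
from the restriction of scalars to `ρW`. -/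
noncomputable def resCoord (ρW : Representation k G W) (ρV : Representation L G V)
    (f : Representation.IntertwiningMap ρV (repBaseChange L ρW)) (c : L →ₗ[k] k) :
    Representation.IntertwiningMap (repRes k ρV) ρW :=
  LinearMap.intertwiningMap_of_isIntertwiningMap _ _
    ((TensorProduct.lid k W).toLinearMap ∘ₗ c.rTensor W ∘ₗ f.toLinearMap.restrictScalars k)
    fun g v ↦ by
      have h : f (ρV g v) = repBaseChange L ρW g (f v) := f.isIntertwining _ _ g v
      change TensorProduct.lid k W (c.rTensor W (f (ρV g v))) =
        ρW g (TensorProduct.lid k W (c.rTensor W (f v)))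
      rw [h]
      induction f v with
      | zero => simp
      | add x y hx hy => simp only [map_add, hx, hy]
      | tmul a w => simp [repBaseChange_apply_tmul_s2]

/-- An element of `L` turns a morphism from the base change of `ρW` into a morphism from `ρW` to
the restriction of scalars. -/
noncomputable def resTmul (ρW : Representation k G W) (ρV : Representation L G V)
    (f : Representation.IntertwiningMap (repBaseChange L ρW) ρV) (a : L) :
    Representation.IntertwiningMap ρW (repRes k ρV) :=
  LinearMap.intertwiningMap_of_isIntertwiningMap _ _
    (f.toLinearMap.restrictScalars k ∘ₗ TensorProduct.mk k L W a)
    fun g w ↦ by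
      have h : f (repBaseChange L ρW g (a ⊗ₜ w)) = ρV g (f (a ⊗ₜ w)) := f.isIntertwining _ _ g _
      change f (a ⊗ₜ ρW g w) = ρV g (f (a ⊗ₜ w))
      rw [← h, repBaseChange_apply_tmul_s2]

theorem sum_resTmul_resCoord {ι : Type*} [Fintype ι] (b : Module.Basis ι k L)
    (ρW : Representation k G W) (ρV : Representation L G V)
    (i : Representation.IntertwiningMap ρV (repBaseChange L ρW))
    (r : Representation.IntertwiningMap (repBaseChange L ρW) ρV) (v : V) :
    ∑ j, resTmul ρW ρV r (b j) (resCoord ρW ρV i (b.coord j) v) = r (i v) := by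
  conv_rhs => rw [← sum_basis_tmul_coord b (i v), map_sum]
  rfl

end Intertwining

/-- Let `F = 𝔽_p`, `K` a finite extension of `F`, `W` an indecomposable `FG`-module and `V` an
indecomposable `KG`-module with `V | W ⊗_F K`.  Then `Res_F V ≅ s • W` for some `s > 0`. -/
theorem res_of_summand_baseChange_isotypic (p : ℕ) [Fact p.Prime]
    (K : Type) [Field K] [Algebra (ZMod p) K] [FiniteDimensional (ZMod p) K]
    (G : Type) [Group G] [Finite G]
    (W : Type) [AddCommGroup W] [Module (ZMod p) W] [FiniteDimensional (ZMod p) W]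
    (ρW : Representation (ZMod p) G W) (hW : RepIndecomposable ρW)
    (V : Type) [AddCommGroup V] [Module (ZMod p) V] [Module K V]
    [IsScalarTower (ZMod p) K V] [FiniteDimensional K V]
    (ρV : Representation K G V) (hV : RepIndecomposable ρV)
    (hVW : RepSummand ρV (repBaseChange K ρW)) :
    ∃ s : ℕ, 0 < s ∧
      Nonempty ((repRes (ZMod p) ρV).asModule ≃ₗ[MonoidAlgebra (ZMod p) G]
        (Fin s → ρW.asModule)) := by
  obtain ⟨i, r, hri⟩ := hVW.exists_retraction
  let b := Module.finBasis (ZMod p) K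
  have : FiniteDimensional (ZMod p) V := Module.Finite.trans K V
  have : IsNoetherian (MonoidAlgebra (ZMod p) G) (repRes (ZMod p) ρV).asModule :=
    isNoetherian_of_tower (ZMod p) inferInstance
  have : IsArtinian (MonoidAlgebra (ZMod p) G) (repRes (ZMod p) ρV).asModule :=
    isArtinian_of_tower (ZMod p) inferInstance
  obtain ⟨s, ⟨f⟩⟩ := exists_linearEquiv_fin_fun_of_retract hW.2
    (fun j ↦ Representation.IntertwiningMap.equivLinearMapAsModule _ _
      (resCoord ρW ρV i (b.coord j)))
    (fun j ↦ Representation.IntertwiningMap.equivLinearMapAsModule _ _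
      (resTmul ρW ρV r (b j)))
    (by
      ext v
      rw [LinearMap.sum_apply]
      exact (sum_resTmul_resCoord b ρW ρV i r v).trans (hri v))
  refine ⟨s, Nat.pos_of_ne_zero ?_, ⟨f⟩⟩
  rintro rfl
  have : Nontrivial (repRes (ZMod p) ρV).asModule := hV.1
  exact not_subsingleton _ f.toEquiv.subsingleton
end

section
/- Let p be a prime, F = 𝔽_p, G a finite group, K a finite field extension of F, W an indecomposable FG-module, and V an indecomposable KG-module with V | W ⊗_F K. Then W is a simple FG-module if and only if V is a simple KG-module. -/
open TensorProduct

section ScalarDescent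

variable {F K A B : Type*} [CommRing F] [Field K] [Algebra F K] [Ring A] [Algebra F A]
  [Ring B] [Algebra K B] {φ : A →+* B}
  {M : Type*} [AddCommGroup M] [Module K M] [Module B M] [IsScalarTower K B M] [Module A M]

theorem smul_mem_of_span_range_eq_top (hφ : Submodule.span K (Set.range φ) = ⊤)
    (hM : ∀ (a : A) (m : M), a • m = φ a • m) (N : Submodule K M)
    (hN : ∀ (a : A), ∀ m ∈ N, a • m ∈ N) (b : B) {m : M} (hm : m ∈ N) : b • m ∈ N := by
  have hb : b ∈ Submodule.span K (Set.range φ) := hφ ▸ Submodule.mem_top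
  induction hb using Submodule.span_induction with
  | mem x hx => obtain ⟨a, rfl⟩ := hx; exact hM a m ▸ hN a m hm
  | zero => simp
  | add x y _ _ hx hy => rw [add_smul]; exact N.add_mem hx hy
  | smul c x _ hx => rw [smul_assoc]; exact N.smul_mem c hx

theorem map_smul_of_span_range_eq_top {N : Type*} [AddCommGroup N] [Module K N] [Module B N]
    [IsScalarTower K B N] [Module A N] (hφ : Submodule.span K (Set.range φ) = ⊤)
    (hM : ∀ (a : A) (m : M), a • m = φ a • m) (hN : ∀ (a : A) (n : N), a • n = φ a • n)
    (f : M →ₗ[K] N) (hf : ∀ (a : A) (m : M), f (a • m) = a • f m) (b : B) (m : M) :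
    f (b • m) = b • f m := by
  have hb : b ∈ Submodule.span K (Set.range φ) := hφ ▸ Submodule.mem_top
  induction hb using Submodule.span_induction with
  | mem x hx => obtain ⟨a, rfl⟩ := hx; rw [← hM, hf, hN]
  | zero => simp
  | add x y _ _ hx hy => rw [add_smul, map_add, hx, hy, add_smul]
  | smul c x _ hx => rw [smul_assoc, map_smul, hx, smul_assoc]

/-- A module generated over `K` by the image of a semisimple `A`-module is semisimple over `A`,
provided the actions of `A` and `K` commute. -/
theorem isSemisimpleModule_of_span_range_eq_top [SMulCommClass A K M] {S : Type*}
    [AddCommGroup S] [Module A S] [IsSemisimpleModule A S] (i : S →ₗ[A] M)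
    (hi : Submodule.span K (Set.range i) = ⊤) : IsSemisimpleModule A M := by
  refine IsSemisimpleModule.of_surjective (Finsupp.lsum ℕ fun k : K => k • i) ?_
  rw [← LinearMap.range_eq_top, eq_top_iff]
  intro x _
  obtain ⟨c, rfl⟩ := Finsupp.mem_span_range_iff_exists_finsupp.mp
    (hi ▸ Submodule.mem_top : x ∈ Submodule.span K (Set.range i))
  exact Submodule.sum_mem _ fun s _ => ⟨Finsupp.single (c s) s, by simp⟩

/-- Twisting an `F`-linear endomorphism `f` by `a ⊗ b` on `K ⊗ K`, giving `a • f (b • ·)`. -/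
noncomputable def tensorTwist [Module F M] [IsScalarTower F K M] (f : M →ₗ[F] M) :
    K ⊗[F] K →ₗ[F] M →ₗ[F] M :=
  TensorProduct.lift
    (((LinearMap.mul F (Module.End F M)).compl₂
      ((LinearMap.mulLeft F f).comp (Algebra.lsmul F F M).toLinearMap)).comp
        (Algebra.lsmul F F M).toLinearMap)

@[simp]
theorem tensorTwist_tmul [Module F M] [IsScalarTower F K M] (f : M →ₗ[F] M) (a b : K) (m : M) :
    tensorTwist f (a ⊗ₜ[F] b) m = a • f (b • m) := rfl

/-- Semisimplicity over `A` implies semisimplicity over `B` when `B` is generated by `A` over an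
unramified extension `K` of `F`: average an `A`-linear projection with a separability
idempotent. -/
theorem isSemisimpleModule_of_formallyUnramified [Algebra.FormallyUnramified F K]
    [Algebra.EssFiniteType F K] [Module F M] [IsScalarTower F K M] [IsScalarTower F A M]
    (hφ : Submodule.span K (Set.range φ) = ⊤) (hM : ∀ (a : A) (m : M), a • m = φ a • m)
    [IsSemisimpleModule A M] : IsSemisimpleModule B M := by
  obtain ⟨t, ht, ht'⟩ := (Algebra.FormallyUnramified.iff_exists_tensorProduct (R := F) (S := K)).mp
    inferInstance
  have hcomm : ∀ (k : K) (a : A) (m : M), k • a • m = a • k • m := fun k a m => by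
    rw [hM, hM, smul_algebra_smul_comm]
  have hker : ∀ s : K, (1 ⊗ₜ[F] s) * t = (s ⊗ₜ[F] 1) * t := fun s => by
    rw [← sub_eq_zero, ← sub_mul, ht]
  refine (isSemisimpleModule_iff _ _).mpr ⟨fun N => ?_⟩
  let N' : Submodule A M :=
    { N.toAddSubmonoid with smul_mem' := fun a m hm => hM a m ▸ N.smul_mem (φ a) hm }
  obtain ⟨h, hh⟩ := IsSemisimpleModule.extension_property N'.subtype N'.injective_subtype
    LinearMap.id
  let π : M →ₗ[F] M := (N'.subtype ∘ₗ h).restrictScalars F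
  have hπA (a : A) (m : M) : π (a • m) = a • π m := map_smul (N'.subtype ∘ₗ h) a m
  have hπN (m : M) : π m ∈ N := (h m).2
  have hπid (m : M) (hm : m ∈ N) : π m = m :=
    congrArg Subtype.val (LinearMap.congr_fun hh ⟨m, hm⟩)
  have hNK (k : K) {m : M} (hm : m ∈ N) : k • m ∈ N := by
    rw [← algebraMap_smul B k m]; exact N.smul_mem _ hm
  have hleft (s : K) (u : K ⊗[F] K) (m : M) :
      tensorTwist π ((s ⊗ₜ[F] 1) * u) m = s • tensorTwist π u m := by
    induction u using TensorProduct.induction_on with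
    | zero => simp
    | tmul a b => simp [mul_smul]
    | add x y hx hy => simp [mul_add, hx, hy]
  have hright (s : K) (u : K ⊗[F] K) (m : M) :
      tensorTwist π ((1 ⊗ₜ[F] s) * u) m = tensorTwist π u (s • m) := by
    induction u using TensorProduct.induction_on with
    | zero => simp
    | tmul a b => simp [mul_smul, smul_comm s b m]
    | add x y hx hy => simp [mul_add, hx, hy]
  have hA (u : K ⊗[F] K) (a : A) (m : M) : tensorTwist π u (a • m) = a • tensorTwist π u m := by
    induction u using TensorProduct.induction_on with
    | zero => simp
    | tmul x y => simp [hcomm, hπA]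
    | add x y hx hy => simp [hx, hy]
  have hmem (u : K ⊗[F] K) (m : M) : tensorTwist π u m ∈ N := by
    induction u using TensorProduct.induction_on with
    | zero => simp
    | tmul x y => exact hNK x (hπN _)
    | add x y hx hy => rw [map_add]; exact N.add_mem hx hy
  have hid (u : K ⊗[F] K) (m : M) (hm : m ∈ N) :
      tensorTwist π u m = Algebra.TensorProduct.lmul' F u • m := by
    induction u using TensorProduct.induction_on with
    | zero => simp
    | tmul x y => simp [hπid _ (hNK y hm), mul_smul]
    | add x y hx hy => simp [hx, hy, add_smul]
  let P : M →ₗ[K] M :=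
    { toFun := tensorTwist π t
      map_add' := map_add _
      map_smul' := fun s m => by rw [← hright, hker, hleft, RingHom.id_apply] }
  let Q : M →ₗ[B] N :=
    { toFun := fun m => ⟨P m, hmem t m⟩
      map_add' := fun x y => Subtype.ext (map_add P x y)
      map_smul' := fun b m => Subtype.ext (map_smul_of_span_range_eq_top hφ hM hM P (hA t) b m) }
  refine ⟨_, LinearMap.isCompl_of_proj (f := Q) fun x => Subtype.ext ?_⟩
  exact (hid t x x.2).trans (by rw [ht', one_smul])

end ScalarDescent

theorem isSimpleModule_of_isSemisimpleModule_of_indecomposable {R M : Type*} [Ring R]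
    [AddCommGroup M] [Module R M] [Nontrivial M] [IsSemisimpleModule R M]
    (hM : ∀ X Y : Submodule R M, IsCompl X Y → X = ⊥ ∨ Y = ⊥) : IsSimpleModule R M := by
  refine (isSimpleModule_iff _ _).mpr { eq_bot_or_eq_top := fun X => ?_ }
  obtain ⟨Y, hXY⟩ := exists_isCompl X
  refine (hM X Y hXY).imp_right ?_
  rintro rfl
  simpa using hXY.sup_eq_top

/-- An indecomposable module `M` is simple if some simple module is a retract of
a module `X` whose identity is a finite sum of endomorphisms factoring through `M`. -/
theorem isSimpleModule_of_retract_of_indecomposable {R S X M ι : Type*} [Ring R]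
    [AddCommGroup S] [Module R S] [AddCommGroup X] [Module R X] [AddCommGroup M] [Module R M]
    [Fintype ι] [IsSimpleModule R S]
    (hM : ∀ Y Z : Submodule R M, IsCompl Y Z → Y = ⊥ ∨ Z = ⊥)
    (i : S →ₗ[R] X) (r : X →ₗ[R] S) (hri : ∀ s, r (i s) = s)
    (u : ι → M →ₗ[R] X) (v : ι → X →ₗ[R] M) (huv : ∀ x, ∑ j, u j (v j x) = x) :
    IsSimpleModule R M := by
  have := IsSimpleModule.nontrivial R S
  obtain ⟨j, hj⟩ : ∃ j, (r ∘ₗ u j) ∘ₗ (v j ∘ₗ i) ≠ 0 := by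
    by_contra! h
    obtain ⟨s, hs⟩ := exists_ne (0 : S)
    apply hs
    rw [← hri s, ← huv (i s), map_sum]
    exact Finset.sum_eq_zero fun j _ => LinearMap.congr_fun (h j) s
  have hbij := LinearMap.bijective_of_ne_zero hj
  have hcompl : IsCompl (LinearMap.range (v j ∘ₗ i)) (LinearMap.ker (r ∘ₗ u j)) := by
    refine ⟨Submodule.disjoint_def.mpr ?_, Submodule.codisjoint_iff_exists_add_eq.mpr fun m => ?_⟩
    · rintro _ ⟨s, rfl⟩ hs
      rw [hbij.1 ((LinearMap.mem_ker.mp hs).trans (map_zero ((r ∘ₗ u j) ∘ₗ v j ∘ₗ i)).symm),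
        map_zero]
    · obtain ⟨s, hs⟩ := hbij.2 ((r ∘ₗ u j) m)
      refine ⟨(v j ∘ₗ i) s, m - (v j ∘ₗ i) s, ⟨s, rfl⟩, ?_, add_sub_cancel _ _⟩
      rw [LinearMap.mem_ker, map_sub, ← hs, LinearMap.comp_apply, sub_self]
  rcases hM _ _ hcompl with h | h
  · exact absurd (by rw [LinearMap.range_eq_bot.mp h, LinearMap.comp_zero]) hj
  · exact IsSimpleModule.congr
      (LinearEquiv.ofBijective (r ∘ₗ u j) ⟨LinearMap.ker_eq_bot.mp h, .of_comp (g := v j ∘ₗ i) hbij.2⟩)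

theorem RepSummand.exists_retract {k : Type*} [CommRing k] {G : Type*} [Monoid G] {V W : Type*}
    [AddCommGroup V] [Module k V] [AddCommGroup W] [Module k W] {ρ : Representation k G V}
    {τ : Representation k G W} (h : RepSummand ρ τ) :
    ∃ (i : ρ.asModule →ₗ[MonoidAlgebra k G] τ.asModule)
      (r : τ.asModule →ₗ[MonoidAlgebra k G] ρ.asModule), ∀ x, r (i x) = x := by
  obtain ⟨N, N', hN, ⟨e⟩⟩ := h
  exact ⟨N.subtype ∘ₗ e, e.symm.toLinearMap ∘ₗ N.projectionOnto N' hN, fun x => by simp⟩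

section BaseChange

variable {F : Type*} (K : Type*) [Field F] [Field K] [Algebra F K] {G : Type*} [Group G]

theorem MonoidAlgebra.span_range_mapRingHom_algebraMap :
    Submodule.span K (Set.range (MonoidAlgebra.mapRingHom G (algebraMap F K))) = ⊤ := by
  refine eq_top_iff.mpr fun b _ => ?_
  induction b using MonoidAlgebra.induction_linear with
  | zero => exact zero_mem _
  | add x y hx hy => exact add_mem (hx trivial) (hy trivial)
  | single g c =>
    have : MonoidAlgebra.single g c =
        c • MonoidAlgebra.mapRingHom G (algebraMap F K) (MonoidAlgebra.single g 1) := by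
      simp
    rw [this]
    exact Submodule.smul_mem _ _ (Submodule.subset_span ⟨_, rfl⟩)

theorem repBaseChange_mapRingHom_smul_tmul {W : Type*} [AddCommGroup W] [Module F W]
    (ρ : Representation F G W) (a : MonoidAlgebra F G) (k : K) (w : ρ.asModule) :
    MonoidAlgebra.mapRingHom G (algebraMap F K) a •
      (show (repBaseChange K ρ).asModule from k ⊗ₜ[F] ρ.asModuleEquiv w) =
    (show (repBaseChange K ρ).asModule from k ⊗ₜ[F] ρ.asModuleEquiv (a • w)) := by
  induction a using MonoidAlgebra.induction_linear with
  | zero => simp; rfl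
  | add x y hx hy => rw [map_add, add_smul, hx, hy, add_smul, map_add, TensorProduct.tmul_add]; rfl
  | single g c =>
    rw [MonoidAlgebra.mapRingHom_single, Representation.single_smul, Representation.single_smul]
    change algebraMap F K c • k ⊗ₜ[F] ρ g (ρ.asModuleEquiv w) =
      k ⊗ₜ[F] (c • ρ g (ρ.asModuleEquiv w))
    rw [algebraMap_smul, TensorProduct.tmul_smul]

end BaseChange

/-- Let `F = 𝔽_p`, `K` a finite extension of `F`, `W` an indecomposable `FG`-module and `V` an
indecomposable `KG`-module with `V | W ⊗_F K`.  Then `W` is simple iff `V` is simple. -/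
theorem simple_iff_simple_of_summand_baseChange (p : ℕ) [Fact p.Prime]
    (K : Type) [Field K] [Algebra (ZMod p) K] [FiniteDimensional (ZMod p) K]
    (G : Type) [Group G] [Finite G]
    (W : Type) [AddCommGroup W] [Module (ZMod p) W] [FiniteDimensional (ZMod p) W]
    (ρW : Representation (ZMod p) G W) (hW : RepIndecomposable ρW)
    (V : Type) [AddCommGroup V] [Module K V] [FiniteDimensional K V]
    (ρV : Representation K G V) (hV : RepIndecomposable ρV)
    (hVW : RepSummand ρV (repBaseChange K ρW)) :
    RepSimple ρW ↔ RepSimple ρV := by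
  let X := (repBaseChange K ρW).asModule
  let A := MonoidAlgebra (ZMod p) G
  let B := MonoidAlgebra K G
  let φ : A →+* B := MonoidAlgebra.mapRingHom G (algebraMap (ZMod p) K)
  have hφ : Submodule.span K (Set.range φ) = ⊤ := MonoidAlgebra.span_range_mapRingHom_algebraMap K
  let : Module A X := Module.compHom X φ
  let : Module A ρV.asModule := Module.compHom ρV.asModule φ
  let : Module (ZMod p) X := Module.compHom X (algebraMap (ZMod p) K)
  have hX : ∀ (a : A) (x : X), a • x = φ a • x := fun _ _ => rfl
  have hV' : ∀ (a : A) (x : ρV.asModule), a • x = φ a • x := fun _ _ => rfl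
  have : IsScalarTower (ZMod p) K X := IsScalarTower.of_algebraMap_smul fun _ _ => rfl
  have : IsScalarTower (ZMod p) A X := IsScalarTower.of_algebraMap_smul fun c x => by
    have : φ (algebraMap (ZMod p) A c) = algebraMap K B (algebraMap (ZMod p) K c) :=
      RingHom.congr_fun (MonoidAlgebra.mapRingHom_comp_algebraMap _) c
    rw [hX, this, algebraMap_smul]
    rfl
  have : SMulCommClass A K X := ⟨fun a k x => by rw [hX, hX, smul_algebra_smul_comm]⟩
  have : SMulCommClass A K ρV.asModule := ⟨fun a k x => by rw [hV', hV', smul_algebra_smul_comm]⟩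
  have : Algebra.FormallyUnramified (ZMod p) K := Algebra.FormallyUnramified.of_isSeparable _ _
  have : Nontrivial ρV.asModule := hV.1
  let u (k : K) : ρW.asModule →ₗ[A] X :=
    { toFun := fun w => k ⊗ₜ[ZMod p] ρW.asModuleEquiv w
      map_add' := fun w w' => TensorProduct.tmul_add k _ _
      map_smul' := fun a w => (repBaseChange_mapRingHom_smul_tmul K ρW a k w).symm }
  obtain ⟨iB, rB, hri⟩ := hVW.exists_retract
  constructor
  · intro (hsimple : IsSimpleModule A ρW.asModule)
    have : IsSemisimpleModule A X := by
      refine isSemisimpleModule_of_span_range_eq_top (K := K) (u 1) (eq_top_iff.mpr fun x _ => ?_)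
      induction x using TensorProduct.induction_on with
      | zero => exact zero_mem _
      | add x y hx hy => exact add_mem (hx trivial) (hy trivial)
      | tmul k w =>
        have : (k ⊗ₜ[ZMod p] w : X) = k • u 1 w := by
          change _ = k • (1 ⊗ₜ[ZMod p] w : K ⊗[ZMod p] W)
          rw [TensorProduct.smul_tmul', smul_eq_mul, mul_one]
        rw [this]
        exact Submodule.smul_mem _ _ (Submodule.subset_span ⟨w, rfl⟩)
    have : IsSemisimpleModule B X := isSemisimpleModule_of_formallyUnramified (F := ZMod p) hφ hX
    have : IsSemisimpleModule B ρV.asModule := 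
      IsSemisimpleModule.of_injective (M := X) iB (Function.LeftInverse.injective hri)
    exact isSimpleModule_of_isSemisimpleModule_of_indecomposable hV.2
  · intro (hsimple : IsSimpleModule B ρV.asModule)
    have : Finite K := Module.finite_of_finite (ZMod p)
    have : Finite ρV.asModule := Module.finite_of_finite K
    have : IsArtinian A ρV.asModule := isArtinian_of_finite
    obtain ⟨S, hS⟩ := IsAtomic.exists_atom (Submodule A ρV.asModule)
    have : IsSimpleModule A S := isSimpleModule_iff_isAtom.mpr hS
    have : IsSemisimpleModule A ρV.asModule := by
      refine isSemisimpleModule_of_span_range_eq_top (K := K) S.subtype ?_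
      let N : Submodule B ρV.asModule :=
        { Submodule.span K (Set.range S.subtype) with
          smul_mem' := fun b x hx => smul_mem_of_span_range_eq_top hφ hV' _ (fun a m hm => by
            induction hm using Submodule.span_induction with
            | mem m hm =>
              obtain ⟨s, rfl⟩ := hm
              exact Submodule.subset_span ⟨a • s, rfl⟩
            | zero => rw [smul_zero]; exact zero_mem _
            | add x y _ _ hx hy => rw [smul_add]; exact add_mem hx hy
            | smul c x _ hx => rw [smul_comm]; exact Submodule.smul_mem _ _ hx) b hx }
      obtain ⟨s, hs, hs0⟩ := S.exists_mem_ne_zero_of_ne_bot hS.1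
      have hN : N = ⊤ := (eq_bot_or_eq_top N).resolve_left fun h => hs0 <|
        (Submodule.mem_bot B).mp (h ▸ (Submodule.subset_span ⟨⟨s, hs⟩, rfl⟩ : s ∈ N))
      exact eq_top_iff.mpr fun x _ => (hN ▸ Submodule.mem_top : x ∈ N)
    obtain ⟨q, hq⟩ := IsSemisimpleModule.extension_property S.subtype S.injective_subtype
      LinearMap.id
    let i : ρV.asModule →ₗ[A] X := { iB with map_smul' := fun a x => map_smul iB (φ a) x }
    let r : X →ₗ[A] ρV.asModule := { rB with map_smul' := fun a x => map_smul rB (φ a) x }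
    let b := Module.finBasis (ZMod p) K
    let coord (j : Fin (Module.finrank (ZMod p) K)) : K ⊗[ZMod p] W →ₗ[ZMod p] W :=
      (TensorProduct.lid (ZMod p) W).toLinearMap ∘ₗ (b.coord j).rTensor W
    let v (j : Fin (Module.finrank (ZMod p) K)) : X →ₗ[A] ρW.asModule :=
      { toFun := fun x => ρW.asModuleEquiv.symm (coord j x)
        map_add' := fun x y => map_add (coord j) x y
        map_smul' := fun a x => by
          induction x using TensorProduct.induction_on with
          | zero =>
            change coord j (a • (0 : X)) = a • ρW.asModuleEquiv.symm (coord j 0)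
            rw [smul_zero, map_zero, map_zero, smul_zero]
            exact map_zero (coord j)
          | add x y hx hy =>
            rw [map_add, map_add, smul_add]
            exact (congrArg (coord j) (smul_add (A := X) a x y)).trans
              ((map_add (coord j) _ _).trans (congrArg₂ (· + ·) hx hy))
          | tmul k w =>
            have h := repBaseChange_mapRingHom_smul_tmul K ρW a k (ρW.asModuleEquiv.symm w)
            exact (congrArg (coord j) h).trans
              (smul_algebra_smul_comm (b.coord j k) a (ρW.asModuleEquiv.symm w)).symm }
    refine isSimpleModule_of_retract_of_indecomposable (X := X) (M := ρW.asModule) hW.2 (i ∘ₗ S.subtype) (q ∘ₗ r)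
      (fun s => ?_) (fun j => u (b j)) v fun x => ?_
    · exact (congrArg q (hri s)).trans (LinearMap.congr_fun hq s)
    · change ∑ j, b j ⊗ₜ[ZMod p] coord j x = x
      induction x using TensorProduct.induction_on with
      | zero => simp
      | add x y hx hy =>
        simp only [map_add, TensorProduct.tmul_add, Finset.sum_add_distrib]
        rw [hx, hy]
      | tmul k w =>
        simp only [coord, LinearMap.comp_apply, LinearMap.rTensor_tmul, LinearEquiv.coe_coe,
          TensorProduct.lid_tmul, TensorProduct.tmul_smul, TensorProduct.smul_tmul',
          ← TensorProduct.sum_tmul]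
        exact congrArg (· ⊗ₜ[ZMod p] w) (b.sum_repr k)
end

section
/- Let p be a prime, F = 𝔽_p, F̄ an algebraic closure of F, G a finite group, and J a subfield of F̄ (an intermediate field F ⊆ J ⊆ F̄). Let X be a finite-dimensional indecomposable JG-module. Then there exist a finite subfield K of J and an indecomposable KG-module Y such that Y ⊗_K J ≅ X as JG-modules. -/
set_option synthInstance.maxHeartbeats 1600000
set_option maxHeartbeats 1600000

open TensorProduct

/-- A module has no nontrivial direct sum decomposition iff its only idempotent endomorphisms
are `0` and `1`. -/
theorem forall_isCompl_eq_bot_iff_forall_isIdempotentElem {R M : Type*} [Ring R] [AddCommGroup M]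
    [Module R M] :
    (∀ A B : Submodule R M, IsCompl A B → A = ⊥ ∨ B = ⊥) ↔
      ∀ e : Module.End R M, IsIdempotentElem e → e = 0 ∨ e = 1 := by
  constructor
  · intro h e he
    refine (h _ _ (LinearMap.IsIdempotentElem.isCompl he)).imp LinearMap.range_eq_bot.mp fun hk ↦ ?_
    ext x
    refine LinearMap.ker_eq_bot.mp hk ?_
    exact LinearMap.congr_fun he x
  · intro h A B hAB
    refine (h _ (Submodule.isIdempotentElem_projection hAB)).imp (fun h0 ↦ ?_) fun h1 ↦ ?_
    · rw [← Submodule.range_projection hAB, h0, LinearMap.range_zero]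
    · rw [← Submodule.ker_projection hAB, h1, Module.End.one_eq_id, LinearMap.ker_id]

/-- A representation over a ring is indecomposable iff it is nonzero and its only idempotent
self-intertwining maps are `0` and `1`. -/
theorem repIndecomposable_iff_forall_isIdempotentElem {k : Type*} [CommRing k] {G : Type*}
    [Monoid G] {V : Type*} [AddCommGroup V] [Module k V] {ρ : Representation k G V} :
    RepIndecomposable ρ ↔
      Nontrivial V ∧ ∀ e : ρ.IntertwiningMap ρ, IsIdempotentElem e → e = 0 ∨ e = 1 := by
  refine and_congr_right fun _ ↦ forall_isCompl_eq_bot_iff_forall_isIdempotentElem.trans ?_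
  let Φ := Representation.IntertwiningMap.equivAlgEnd ρ
  constructor
  · intro h e he
    refine (h (Φ e) (he.map Φ)).imp (fun h0 ↦ ?_) fun h1 ↦ ?_
    · exact Φ.injective (h0.trans (map_zero Φ).symm)
    · exact Φ.injective (h1.trans (map_one Φ).symm)
  · intro h e he
    refine (h (Φ.symm e) (he.map Φ.symm)).imp (fun h0 ↦ ?_) fun h1 ↦ ?_
    · exact Φ.symm.injective (h0.trans (map_zero Φ.symm).symm)
    · exact Φ.symm.injective (h1.trans (map_one Φ.symm).symm)

/-- Indecomposability is invariant under isomorphism. -/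
theorem RepIso.repIndecomposable {k : Type*} [CommRing k] {G : Type*} [Monoid G]
    {V W : Type*} [AddCommGroup V] [Module k V] [AddCommGroup W] [Module k W]
    {ρ : Representation k G V} {τ : Representation k G W} (h : RepIso ρ τ)
    (hτ : RepIndecomposable τ) : RepIndecomposable ρ := by
  obtain ⟨T⟩ := h
  refine ⟨?_, fun A B hAB ↦ ?_⟩
  · have : Nontrivial τ.asModule := hτ.1
    exact T.toEquiv.nontrivial
  · have := hτ.2 _ _ ((Submodule.orderIsoMapComap T).isCompl hAB)
    simpa using this

/-- An equivariant linear equivalence gives an isomorphism of representations. -/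
theorem RepIso.of_linearEquiv {k : Type*} [CommSemiring k] {G : Type*} [Monoid G]
    {V W : Type*} [AddCommMonoid V] [Module k V] [AddCommMonoid W] [Module k W]
    {ρ : Representation k G V} {τ : Representation k G W} (T : V ≃ₗ[k] W)
    (hT : ∀ g, T.toLinearMap ∘ₗ ρ g = τ g ∘ₗ T.toLinearMap) : RepIso ρ τ :=
  ⟨LinearEquiv.ofBijective (Representation.IntertwiningMap.equivLinearMapAsModule ρ τ ⟨T.toLinearMap, hT⟩)
    T.bijective⟩

@[simp]
theorem repBaseChange_apply {k : Type*} [CommRing k] (L : Type*) [CommRing L] [Algebra k L]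
    {G : Type*} [Monoid G] {V : Type*} [AddCommGroup V] [Module k V]
    (ρ : Representation k G V) (g : G) : repBaseChange L ρ g = (ρ g).baseChange L :=
  rfl

/-- If the base change of a representation to an extension field is indecomposable, then so is the
representation. -/
theorem RepIndecomposable.of_repBaseChange {k L : Type*} [Field k] [Field L] [Algebra k L]
    {G : Type*} [Monoid G] {V : Type*} [AddCommGroup V] [Module k V]
    {ρ : Representation k G V} (h : RepIndecomposable (repBaseChange L ρ)) :
    RepIndecomposable ρ := by
  rw [repIndecomposable_iff_forall_isIdempotentElem] at h ⊢
  obtain ⟨hnt, h⟩ := h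
  refine ⟨?_, fun e he ↦ ?_⟩
  · by_contra hV
    rw [not_nontrivial_iff_subsingleton] at hV
    exact not_subsingleton (L ⊗[k] V) inferInstance
  · let e' : (repBaseChange L ρ).IntertwiningMap (repBaseChange L ρ) :=
      ⟨e.toLinearMap.baseChange L, fun g ↦ by
        rw [repBaseChange_apply, ← LinearMap.baseChange_comp, ← LinearMap.baseChange_comp,
          e.isIntertwining']⟩
    have he' : IsIdempotentElem e' := by
      apply Representation.IntertwiningMap.ext
      change e.toLinearMap.baseChange L * e.toLinearMap.baseChange L = e.toLinearMap.baseChange L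
      rw [← LinearMap.baseChange_mul, ← Representation.IntertwiningMap.coe_mul, he.eq]
    have inj := LinearMap.baseChangeHom_injective (R := k) (S := L) (M := V) (N := V)
    refine (h e' he').imp (fun h0 ↦ ?_) fun h1 ↦ ?_
    · apply Representation.IntertwiningMap.ext
      apply inj
      exact (congrArg (·.toLinearMap) h0).trans (LinearMap.baseChange_zero (R := k) (A := L)).symm
    · apply Representation.IntertwiningMap.ext
      apply inj
      exact (congrArg (·.toLinearMap) h1).trans (LinearMap.baseChange_one k V (A := L)).symm

/-- A representation whose matrix coefficients with respect to a basis lie in a subfield is obtained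
by base change from that subfield. -/
theorem exists_repBaseChange_repIso_of_toMatrix_mem_range {k L : Type*} [Field k] [Field L]
    [Algebra k L] {G : Type*} [Monoid G] {V : Type*} [AddCommGroup V] [Module L V]
    {ι : Type*} [Fintype ι] [DecidableEq ι] (b : Module.Basis ι L V) (ρ : Representation L G V)
    (h : ∀ g i j, LinearMap.toMatrix b b (ρ g) i j ∈ Set.range (algebraMap k L)) :
    ∃ τ : Representation k G (ι → k), RepIso (repBaseChange L τ) ρ := by
  choose M hM using h
  have hM' (g : G) : (Matrix.of (M g)).map (algebraMap k L) = LinearMap.toMatrix b b (ρ g) := by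
    ext i j
    exact hM g i j
  have inj : Function.Injective fun A : Matrix ι ι k ↦ A.map (algebraMap k L) :=
    Matrix.map_injective (algebraMap k L).injective
  let τ : Representation k G (ι → k) :=
    { toFun g := Matrix.toLin' (Matrix.of (M g))
      map_one' := by
        rw [← Matrix.toLin'_one.trans Module.End.one_eq_id.symm]
        congr 1
        apply inj
        simp [hM']
      map_mul' g g' := by
        rw [Module.End.mul_eq_comp, ← Matrix.toLin'_mul]
        congr 1
        apply inj
        simp only [hM', Matrix.map_mul, map_mul, LinearMap.toMatrix_mul] }
  refine ⟨τ, RepIso.of_linearEquiv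
    (((Pi.basisFun k ι).baseChange L).equiv b (Equiv.refl ι)) fun g ↦ ?_⟩
  refine ((Pi.basisFun k ι).baseChange L).ext fun i ↦ ?_
  have key : ρ g (b i) = ∑ j, algebraMap k L (M g j i) • b j := by
    rw [← b.sum_repr (ρ g (b i))]
    simp [hM, LinearMap.toMatrix_apply]
  have hτ : τ g (Pi.basisFun k ι i) = ∑ j, M g j i • Pi.basisFun k ι j := by
    ext j
    simp [τ, Pi.single_apply]
  have hb (j : ι) : (((Pi.basisFun k ι).baseChange L).equiv b (Equiv.refl ι))
      (1 ⊗ₜ Pi.basisFun k ι j) = b j := by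
    rw [← Module.Basis.baseChange_apply, Module.Basis.equiv_apply, Equiv.refl_apply]
  simp only [LinearMap.comp_apply, LinearEquiv.coe_coe, Module.Basis.baseChange_apply,
    repBaseChange_apply, LinearMap.baseChange_tmul, hb, hτ, key, TensorProduct.tmul_sum, map_sum]
  refine Finset.sum_congr rfl fun j _ ↦ ?_
  rw [TensorProduct.tmul_smul, ← algebraMap_smul L, map_smul, hb]

/-- Let `F = 𝔽_p`, `F̄` an algebraic closure of `F`, `J` a subfield of `F̄`, and `X` a
finite-dimensional indecomposable `JG`-module.  Then there are a finite subfield `K` of `J` and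
an indecomposable `KG`-module `Y` with `Y ⊗_K J ≅ X`. -/
theorem exists_finite_subfield_form_of_indecomposable (p : ℕ) [Fact p.Prime]
    (G : Type) [Group G] [Finite G]
    (J : IntermediateField (ZMod p) (AlgebraicClosure (ZMod p)))
    (X : Type) [AddCommGroup X] [Module ↥J X] [FiniteDimensional ↥J X]
    (ρX : Representation ↥J G X) (hX : RepIndecomposable ρX) :
    ∃ K : IntermediateField (ZMod p) ↥J, Finite ↥K ∧
      ∃ Y : FDRep ↥K G, RepIndecomposable Y.ρ ∧ RepIso (repBaseChange ↥J Y.ρ) ρX := by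
  let b := Module.finBasis J X
  let S : Set J := Set.range fun x : G × Fin _ × Fin _ ↦
    LinearMap.toMatrix b b (ρX x.1) x.2.1 x.2.2
  let K : IntermediateField (ZMod p) J := IntermediateField.adjoin (ZMod p) S
  have : FiniteDimensional (ZMod p) K :=
    have : Finite S := Set.finite_range _
    IntermediateField.finiteDimensional_adjoin fun x _ ↦ Algebra.IsIntegral.isIntegral x
  obtain ⟨τ, hτ⟩ := exists_repBaseChange_repIso_of_toMatrix_mem_range (k := K) b ρX fun g i j ↦
    ⟨⟨_, IntermediateField.subset_adjoin (ZMod p) S ⟨(g, i, j), rfl⟩⟩, rfl⟩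
  exact ⟨K, Module.finite_of_finite (ZMod p), FDRep.of τ,
    (hτ.repIndecomposable hX).of_repBaseChange, hτ⟩
end

section
/- Let p be a prime, F = 𝔽_p, G a finite group, K a finite field extension of F, W a simple FG-module, and V an indecomposable KG-module with V | W ⊗_F K. Then V is a simple KG-module. -/
open TensorProduct

/-- The `F`-linear map sending `x ⊗ y` to `m ↦ x • f (y • m)`. -/
noncomputable def sandwich {F K M : Type*} [CommRing F] [CommRing K] [Algebra F K]
    [AddCommGroup M] [Module F M] [Module K M] [IsScalarTower F K M] (f : Module.End F M) :
    K ⊗[F] K →ₗ[F] Module.End F M :=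
  TensorProduct.lift ((LinearMap.mul F (Module.End F M)).compl₁₂
    (LinearMap.mulRight F f ∘ₗ (Algebra.lsmul F F M : K →ₐ[F] _).toLinearMap)
    (Algebra.lsmul F F M : K →ₐ[F] _).toLinearMap)

section sandwich

variable {F K M : Type*} [CommRing F] [CommRing K] [Algebra F K]
  [AddCommGroup M] [Module F M] [Module K M] [IsScalarTower F K M] (f : Module.End F M)

@[simp]
theorem sandwich_tmul (x y : K) (m : M) : sandwich f (x ⊗ₜ[F] y) m = x • f (y • m) := rfl

theorem sandwich_tmul_one_mul (k : K) (t : K ⊗[F] K) (m : M) :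
    sandwich f ((k ⊗ₜ[F] 1) * t) m = k • sandwich f t m := by
  induction t with
  | zero => simp
  | tmul x y => simp [mul_smul]
  | add x y hx hy => simp [mul_add, hx, hy]

theorem sandwich_one_tmul_mul (k : K) (t : K ⊗[F] K) (m : M) :
    sandwich f ((1 ⊗ₜ[F] k) * t) m = sandwich f t (k • m) := by
  induction t with
  | zero => simp
  | tmul x y => simp [smul_smul, mul_comm]
  | add x y hx hy => simp [mul_add, hx, hy]

theorem sandwich_mem (A : Submodule K M) (hf : ∀ m, f m ∈ A) (t : K ⊗[F] K) (m : M) :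
    sandwich f t m ∈ A := by
  induction t with
  | zero => simp
  | tmul x y => exact A.smul_mem _ (hf _)
  | add x y hx hy => simpa using A.add_mem hx hy

theorem sandwich_apply_of_mem (A : Submodule K M) (hf : ∀ m ∈ A, f m = m) (t : K ⊗[F] K)
    {m : M} (hm : m ∈ A) :
    sandwich f t m = Algebra.TensorProduct.lmul' F t • m := by
  induction t with
  | zero => simp
  | tmul x y => simp [hf _ (A.smul_mem y hm), mul_smul]
  | add x y hx hy => simp [add_smul, hx, hy]

theorem sandwich_apply_comm (g : Module.End K M) (hf : ∀ m, f (g m) = g (f m)) (t : K ⊗[F] K)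
    (m : M) : sandwich f t (g m) = g (sandwich f t m) := by
  induction t with
  | zero => simp
  | tmul x y => rw [sandwich_tmul, sandwich_tmul, ← map_smul g, hf, ← map_smul g]
  | add x y hx hy => simp [hx, hy]

/-- Averaging an `F`-linear endomorphism over the separability element gives a `K`-linear one. -/
noncomputable def separableAverage [Algebra.FormallyUnramified F K] [Algebra.EssFiniteType F K] :
    Module.End K M where
  toFun := sandwich f (Algebra.FormallyUnramified.elem F K)
  map_add' := map_add _
  map_smul' k m := by
    rw [← sandwich_one_tmul_mul, Algebra.FormallyUnramified.one_tmul_mul_elem,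
      sandwich_tmul_one_mul, RingHom.id_apply]

end sandwich

/-- A `K[G]`-module is semisimple if its restriction to `F[G]` is, for `K` finite separable
over `F`. -/
theorem isSemisimpleModule_of_restrictScalars {F K G M : Type*} [Field F] [Field K] [Algebra F K]
    [FiniteDimensional F K] [Algebra.IsSeparable F K] [Monoid G] [AddCommGroup M] [Module F M]
    [Module K M] [IsScalarTower F K M] [Module (MonoidAlgebra F G) M]
    [IsScalarTower F (MonoidAlgebra F G) M] [Module (MonoidAlgebra K G) M]
    [IsScalarTower K (MonoidAlgebra K G) M]
    (h : ∀ (c : MonoidAlgebra F G) (m : M),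
      c • m = MonoidAlgebra.mapRingHom G (algebraMap F K) c • m)
    [IsSemisimpleModule (MonoidAlgebra F G) M] : IsSemisimpleModule (MonoidAlgebra K G) M := by
  have : Algebra.FormallyUnramified F K := .of_isSeparable F K
  refine (isSemisimpleModule_iff _ _).mpr ⟨fun A => ?_⟩
  let A' : Submodule (MonoidAlgebra F G) M :=
    { A with smul_mem' := fun c m hm => by rw [h]; exact A.smul_mem _ hm }
  obtain ⟨B, hAB⟩ := exists_isCompl A'
  let π : M →ₗ[MonoidAlgebra F G] M := A'.subtype ∘ₗ A'.projectionOnto B hAB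
  let f : Module.End F M := π.restrictScalars F
  have hfA (m : M) : f m ∈ A := (A'.projectionOnto B hAB m).2
  have hf (m : M) (hm : m ∈ A) : f m = m :=
    congrArg Subtype.val (Submodule.projectionOnto_apply_left hAB ⟨m, hm⟩)
  have hcomm (g : G) (m : M) : f (MonoidAlgebra.single g (1 : K) • m) =
      MonoidAlgebra.single g (1 : K) • f m := by
    have hg (m : M) : MonoidAlgebra.single g (1 : K) • m = MonoidAlgebra.single g (1 : F) • m := by
      simp [h]
    rw [hg, hg]
    exact map_smul π _ m
  let AK : Submodule K M := A.restrictScalars K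
  let q : M →ₗ[MonoidAlgebra K G] M :=
    MonoidAlgebra.equivariantOfLinearOfComm (separableAverage (K := K) f) fun g m =>
      sandwich_apply_comm f (MonoidAlgebra.GroupSMul.linearMap K M g) (hcomm g) _ m
  let r : M →ₗ[MonoidAlgebra K G] A := q.codRestrict A fun m => sandwich_mem f AK hfA _ m
  refine ⟨LinearMap.ker r, LinearMap.isCompl_of_proj fun m => Subtype.ext ?_⟩
  refine (sandwich_apply_of_mem f AK hf _ m.2).trans ?_
  rw [Algebra.FormallyUnramified.lmul_elem, one_smul]

/-- If a `K[G]`-module `M` is spanned over `K` by the image of a semisimple `F[G]`-module under a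
`G`-equivariant `F`-linear map, then `M` is semisimple, for `K` finite separable over `F`. -/
theorem isSemisimpleModule_of_span_range {F K G N M : Type*} [Field F] [Field K] [Algebra F K]
    [FiniteDimensional F K] [Algebra.IsSeparable F K] [Monoid G] [AddCommGroup N] [Module F N]
    [Module (MonoidAlgebra F G) N] [IsScalarTower F (MonoidAlgebra F G) N]
    [AddCommGroup M] [Module F M] [Module K M] [IsScalarTower F K M] [Module (MonoidAlgebra K G) M]
    [IsScalarTower K (MonoidAlgebra K G) M] [IsSemisimpleModule (MonoidAlgebra F G) N]
    (φ : N →ₗ[F] M)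
    (hφ : ∀ (g : G) (n : N),
      φ (MonoidAlgebra.single g (1 : F) • n) = MonoidAlgebra.single g (1 : K) • φ n)
    (hspan : Submodule.span K (Set.range φ) = ⊤) : IsSemisimpleModule (MonoidAlgebra K G) M := by
  let : Module (MonoidAlgebra F G) M :=
    Module.compHom M (MonoidAlgebra.mapRingHom G (algebraMap F K))
  have h (c : MonoidAlgebra F G) (m : M) :
      c • m = MonoidAlgebra.mapRingHom G (algebraMap F K) c • m := rfl
  have : IsScalarTower F (MonoidAlgebra F G) M := ⟨fun a c m => by
    rw [h, h, ← algebraMap_smul K a (_ • m), ← smul_assoc]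
    congr 1
    ext g
    simp [Algebra.smul_def]⟩
  let incl (k : K) : N →ₗ[MonoidAlgebra F G] M :=
    MonoidAlgebra.equivariantOfLinearOfComm ((Algebra.lsmul F F M k) ∘ₗ φ) fun g n => by
      have hc := map_smul (MonoidAlgebra.GroupSMul.linearMap K M g) k (φ n)
      simp only [MonoidAlgebra.GroupSMul.linearMap_apply] at hc
      simp [h, hφ, hc]
  have hss (k : K) : IsSemisimpleModule (MonoidAlgebra F G) (LinearMap.range (incl k)) := .range _
  have htop : ⨆ k, LinearMap.range (incl k) = ⊤ := by
    refine eq_top_iff.mpr fun m _ => ?_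
    have hm : m ∈ Submodule.span K (Set.range φ) := hspan ▸ Submodule.mem_top
    rw [Finsupp.mem_span_range_iff_exists_finsupp] at hm
    obtain ⟨c, rfl⟩ := hm
    exact Submodule.sum_mem _ fun n _ => Submodule.mem_iSup_of_mem (c n) ⟨n, rfl⟩
  have : IsSemisimpleModule (MonoidAlgebra F G) M :=
    isSemisimpleModule_of_isSemisimpleModule_submodule' hss htop
  exact isSemisimpleModule_of_restrictScalars h

theorem span_range_mk_one (F K W : Type*) [CommRing F] [CommRing K] [Algebra F K] [AddCommGroup W]
    [Module F W] : Submodule.span K (Set.range (TensorProduct.mk F K W 1)) = ⊤ := by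
  refine eq_top_iff.mpr fun m _ => ?_
  induction m with
  | zero => exact Submodule.zero_mem _
  | tmul k w =>
    have hw : TensorProduct.mk F K W 1 w ∈ Submodule.span K (Set.range (TensorProduct.mk F K W 1)) :=
      Submodule.subset_span ⟨w, rfl⟩
    simpa [TensorProduct.smul_tmul'] using Submodule.smul_mem _ k hw
  | add x y hx hy => exact Submodule.add_mem _ (hx trivial) (hy trivial)

/-- Base change along a finite separable extension turns simple representations into semisimple
ones. -/
theorem isSemisimpleModule_repBaseChange {F : Type*} (K : Type*) {G W : Type*} [Field F] [Field K]
    [Algebra F K] [FiniteDimensional F K] [Algebra.IsSeparable F K] [Monoid G] [AddCommGroup W]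
    [Module F W] (ρ : Representation F G W) (hρ : RepSimple ρ) :
    IsSemisimpleModule (MonoidAlgebra K G) (repBaseChange K ρ).asModule := by
  have : IsSimpleModule (MonoidAlgebra F G) ρ.asModule := hρ
  let : Module F (repBaseChange K ρ).asModule := inferInstanceAs (Module F (K ⊗[F] W))
  have : IsScalarTower F K (repBaseChange K ρ).asModule :=
    inferInstanceAs (IsScalarTower F K (K ⊗[F] W))
  let φ : ρ.asModule →ₗ[F] (repBaseChange K ρ).asModule := TensorProduct.mk F K W 1
  refine isSemisimpleModule_of_span_range φ (fun g w => ?_) ?_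
  · rw [Representation.single_smul, Representation.single_smul, one_smul, one_smul]
    rfl
  · exact span_range_mk_one F K W

/-- Let `F = 𝔽_p`, `K` a finite extension of `F`, `W` a simple `FG`-module and `V` an
indecomposable `KG`-module with `V | W ⊗_F K`.  Then `V` is simple. -/
theorem simple_of_summand_baseChange_of_simple (p : ℕ) [Fact p.Prime]
    (K : Type) [Field K] [Algebra (ZMod p) K] [FiniteDimensional (ZMod p) K]
    (G : Type) [Group G] [Finite G]
    (W : Type) [AddCommGroup W] [Module (ZMod p) W] [FiniteDimensional (ZMod p) W]
    (ρW : Representation (ZMod p) G W) (hW : RepSimple ρW)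
    (V : Type) [AddCommGroup V] [Module K V] [FiniteDimensional K V]
    (ρV : Representation K G V) (hV : RepIndecomposable ρV)
    (hVW : RepSummand ρV (repBaseChange K ρW)) :
    RepSimple ρV := by
  have := isSemisimpleModule_repBaseChange K ρW hW
  obtain ⟨A, -, -, ⟨e⟩⟩ := hVW
  have : IsSemisimpleModule (MonoidAlgebra K G) ρV.asModule :=
    .of_injective (N := ρV.asModule) (M := (repBaseChange K ρW).asModule) (A.subtype ∘ₗ e.toLinearMap)
      (A.subtype_injective.comp e.injective)
  have : Nontrivial ρV.asModule := hV.1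
  refine (isSimpleModule_iff _ _).mpr ⟨fun A => ?_⟩
  obtain ⟨B, hAB⟩ := exists_isCompl A
  refine (hV.2 A B hAB).imp id fun hB => ?_
  simpa [hB] using hAB.sup_eq_top
end
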